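/- arXiv:2511.09703 — 2 statements merged into one kernel-verified Lean document; each statement's English description precedes it below -/
import Mathlib

section
/- Let x ∈ ℝ^Q and c ∈ ℝ be such that x^T M(u) β = c holds for all words u ∈ Σ* of minimum rank. Then x^T M(w) β = c holds for all words w ∈ Σ*. -/
open Matrix

/-- Indicator (0/1) column vector of a set of states: `ind S q = 1` iff `q ∈ S`. -/
noncomputable def ind {Q : Type*} (S : Set Q) : Q → ℝ := S.indicator 1

namespace UFA

variable {Q σ : Type*}

/-- `y` is a column of the monoid morphism `M`, i.e. `y = M(w)[q]` for some word `w`, state `q`. -/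
def IsCol (M : List σ → Matrix Q Q ℝ) (y : Q → ℝ) : Prop :=
  ∃ w : List σ, ∃ q : Q, y = fun p => M w p q

/-- `x` is a row of `M`, i.e. `xᵀ = [q]ᵀ M(w)` for some word `w` and state `q`. -/
def IsRow (M : List σ → Matrix Q Q ℝ) (x : Q → ℝ) : Prop :=
  ∃ w : List σ, ∃ q : Q, x = fun p => M w q p

/-- A maximal column: a column `y` such that no column `y' ≠ y` satisfies `y' ≥ y`. -/
def IsMaxCol (M : List σ → Matrix Q Q ℝ) (y : Q → ℝ) : Prop :=
  IsCol M y ∧ ∀ y', IsCol M y' → y ≤ y' → y' = y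

/-- A maximal row: a row `x` such that no row `x' ≠ x` satisfies `x' ≥ x`. -/
def IsMaxRow (M : List σ → Matrix Q Q ℝ) (x : Q → ℝ) : Prop :=
  IsRow M x ∧ ∀ x', IsRow M x' → x ≤ x' → x' = x

/-- Unambiguous rank of a zero-one matrix: the least `r` such that `A = C * R` with `C, R`
zero-one matrices having `r` columns resp. `r` rows. -/
noncomputable def rankUnMat (A : Matrix Q Q ℝ) : ℕ :=
  sInf {r : ℕ | ∃ C : Matrix Q (Fin r) ℝ, ∃ R : Matrix (Fin r) Q ℝ,
    (∀ i j, C i j = 0 ∨ C i j = 1) ∧ (∀ i j, R i j = 0 ∨ R i j = 1) ∧ A = C * R}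

/-- Minimum unambiguous rank of the matrix monoid generated by `M`. -/
noncomputable def rankUn (M : List σ → Matrix Q Q ℝ) : ℕ :=
  sInf (Set.range fun w => rankUnMat (M w))

/-- Minimum real rank of the matrix monoid generated by `M`. -/
noncomputable def rankReal [Fintype Q] (M : List σ → Matrix Q Q ℝ) : ℕ :=
  sInf (Set.range fun w => (M w).rank)

/-- `Mer M q`: the set of states that appear together with `q` in some column. -/
def Mer (M : List σ → Matrix Q Q ℝ) (q : Q) : Set Q :=
  {q' | ∃ S : Set Q, q ∈ S ∧ q' ∈ S ∧ IsCol M (ind S)}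

end UFA

namespace UFA

variable {Q σ : Type*} [Fintype Q]

theorem exists_rankUnMat_factorization {A : Matrix Q Q ℝ} (hA : ∀ i j, A i j = 0 ∨ A i j = 1) :
    ∃ C : Matrix Q (Fin (rankUnMat A)) ℝ, ∃ R : Matrix (Fin (rankUnMat A)) Q ℝ,
      (∀ i j, C i j = 0 ∨ C i j = 1) ∧ (∀ i j, R i j = 0 ∨ R i j = 1) ∧ A = C * R := by
  classical
  refine Nat.sInf_mem (s := {r : ℕ | ∃ C : Matrix Q (Fin r) ℝ, ∃ R : Matrix (Fin r) Q ℝ,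
    (∀ i j, C i j = 0 ∨ C i j = 1) ∧ (∀ i j, R i j = 0 ∨ R i j = 1) ∧ A = C * R}) ?_
  let e := Fintype.equivFin Q
  refine ⟨Fintype.card Q, A.submatrix id e.symm, (1 : Matrix Q Q ℝ).submatrix e.symm id,
    fun i j => hA _ _, fun i j => ?_, ?_⟩
  · by_cases h : e.symm i = j <;> simp [Matrix.one_apply, h]
  · rw [Matrix.submatrix_mul_equiv, Matrix.mul_one, Matrix.submatrix_id_id]

/-- Multiplying a zero-one matrix on the left by a zero-one matrix does not increase its
unambiguous rank, provided the product is again zero-one. -/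
theorem rankUnMat_mul_le {A B : Matrix Q Q ℝ} (hA : ∀ i j, A i j = 0 ∨ A i j = 1)
    (hB : ∀ i j, B i j = 0 ∨ B i j = 1) (hBA : ∀ i j, (B * A) i j = 0 ∨ (B * A) i j = 1) :
    rankUnMat (B * A) ≤ rankUnMat A := by
  classical
  obtain ⟨C, R, hC, hR, h⟩ := exists_rankUnMat_factorization hA
  have hnat : ∀ i j, ∃ n : ℕ, (B * C) i j = n := by
    intro i j
    have : ∀ k, ∃ n : ℕ, B i k * C k j = n := by
      intro k
      rcases hB i k with h1 | h1 <;> rcases hC k j with h2 | h2 <;> rw [h1, h2]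
      exacts [⟨0, by simp⟩, ⟨0, by simp⟩, ⟨0, by simp⟩, ⟨1, by simp⟩]
    choose f hf using this
    exact ⟨∑ k, f k, by simp [Matrix.mul_apply, hf]⟩
  refine Nat.sInf_le ⟨Matrix.of fun i j => if R j = 0 then 0 else (B * C) i j, R, fun i j => ?_, hR, ?_⟩
  · by_cases hj : R j = 0
    · simp [hj]
    · obtain ⟨k, hk⟩ := Function.ne_iff.1 hj
      have hk1 : R j k = 1 := (hR j k).resolve_left hk
      have hle : (B * C) i j * R j k ≤ (B * A) i k := by
        have hsum : (B * A) i k = ∑ l, (B * C) i l * R l k := by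
          conv_lhs => rw [h, ← Matrix.mul_assoc, Matrix.mul_apply]
        rw [hsum]
        refine Finset.single_le_sum (f := fun l => (B * C) i l * R l k) (fun l _ => ?_)
          (Finset.mem_univ j)
        obtain ⟨n, hn⟩ := hnat i l
        rcases hR l k with h1 | h1 <;> simp [hn, h1]
      have hone : (B * A) i k ≤ 1 := by rcases hBA i k with h1 | h1 <;> simp [h1]
      obtain ⟨n, hn⟩ := hnat i j
      rw [hk1, mul_one, hn] at hle
      have hn1 : n ≤ 1 := by exact_mod_cast hle.trans hone
      simp only [Matrix.of_apply, hj, if_false, hn]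
      interval_cases n <;> simp
  · conv_lhs => rw [h, ← Matrix.mul_assoc]
    ext i k
    rw [Matrix.mul_apply, Matrix.mul_apply]
    refine Finset.sum_congr rfl fun j _ => ?_
    by_cases hj : R j = 0 <;> simp [hj]

theorem rankUnMat_append_eq_rankUn {M : List σ → Matrix Q Q ℝ}
    (hMm : ∀ u v, M (u ++ v) = M u * M v) (hUn : ∀ w i j, M w i j = 0 ∨ M w i j = 1)
    {u : List σ} (hu : rankUnMat (M u) = rankUn M) (w : List σ) :
    rankUnMat (M (w ++ u)) = rankUn M := by
  refine le_antisymm ?_ (Nat.sInf_le ⟨w ++ u, rfl⟩)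
  rw [← hu, hMm]
  exact rankUnMat_mul_le (hUn u) (hUn w) fun i j => hMm w u ▸ hUn (w ++ u) i j

/-- Maximum principle: a function on words with finitely many values that is the average of its
values on one-letter extensions is bounded by any value it takes on all words ending in `u`. -/
theorem le_of_average_of_append_eq [Fintype σ] {f : List σ → ℝ} (hfin : (Set.range f).Finite)
    (hf : ∀ w, ∑ a : σ, f (w ++ [a]) = Fintype.card σ * f w) {u : List σ} {c : ℝ}
    (hu : ∀ w, f (w ++ u) = c) (w : List σ) : f w ≤ c := by
  obtain ⟨-, ⟨m, rfl⟩, hm⟩ := hfin.exists_maximal (Set.range_nonempty f)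
  have hmax : ∀ v, f v ≤ f m := fun v => by
    by_contra! hv
    exact hv.not_ge (hm ⟨v, rfl⟩ hv.le)
  have hstep : ∀ v, f v = f m → ∀ a, f (v ++ [a]) = f m := by
    intro v hv a
    have hsum : ∑ a : σ, f (v ++ [a]) = ∑ _a : σ, f m := by simp [hf, hv]
    exact (Finset.sum_eq_sum_iff_of_le fun a _ => hmax _).1 hsum a (Finset.mem_univ a)
  have hext : ∀ v, f (m ++ v) = f m := by
    intro v
    induction v using List.reverseRecOn with
    | nil => simp
    | append_singleton v a ih => rw [← List.append_assoc]; exact hstep _ ih a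
  exact (hmax w).trans ((hext u).symm.trans (hu m)).le

theorem finite_range_of_zero_one {M : List σ → Matrix Q Q ℝ}
    (hUn : ∀ w i j, M w i j = 0 ∨ M w i j = 1) : (Set.range M).Finite := by
  have hfin : {A : Q → Q → ℝ | ∀ i, A i ∈ {v : Q → ℝ | ∀ j, v j ∈ ({0, 1} : Set ℝ)}}.Finite :=
    Set.Finite.pi' fun _ => Set.Finite.pi' fun _ => Set.toFinite _
  refine hfin.subset ?_
  rintro _ ⟨w, rfl⟩ i j
  exact hUn w i j

theorem sum_dotProduct_append_mulVec [Fintype σ] [Nonempty σ] {M : List σ → Matrix Q Q ℝ}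
    (hMm : ∀ u v, M (u ++ v) = M u * M v) {β : Q → ℝ}
    (hβA : ((Fintype.card σ : ℝ)⁻¹ • ∑ a : σ, M [a]) *ᵥ β = β) (x : Q → ℝ) (w : List σ) :
    ∑ a : σ, x ⬝ᵥ (M (w ++ [a]) *ᵥ β) = Fintype.card σ * (x ⬝ᵥ (M w *ᵥ β)) := by
  have hcard : (Fintype.card σ : ℝ) ≠ 0 := Nat.cast_ne_zero.2 Fintype.card_ne_zero
  have hsum : (∑ a : σ, M [a]) *ᵥ β = (Fintype.card σ : ℝ) • β := by
    conv_rhs => rw [← hβA, Matrix.smul_mulVec, smul_inv_smul₀ hcard]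
  simp_rw [hMm, ← Matrix.mulVec_mulVec]
  rw [← dotProduct_sum, ← Matrix.mulVec_sum, ← Matrix.sum_mulVec, hsum, Matrix.mulVec_smul,
    dotProduct_smul, smul_eq_mul]

end UFA

theorem constant_on_minrank_extends {Q σ : Type*} [Fintype Q] [DecidableEq Q] [Nonempty Q]
    [Fintype σ] [Nonempty σ]
    (M : List σ → Matrix Q Q ℝ)
    (hM0 : M [] = 1) (hMm : ∀ u v, M (u ++ v) = M u * M v)
    (hUn : ∀ w i j, M w i j = 0 ∨ M w i j = 1)
    (hComp : ∀ w, M w ≠ 0)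
    (hSC : ∀ p q : Q, ∃ w, M w p q = 1)
    (α β : Q → ℝ) (hα : ∀ q, 0 < α q) (hβ : ∀ q, 0 < β q)
    (hαA : α ᵥ* ((Fintype.card σ : ℝ)⁻¹ • ∑ a : σ, M [a]) = α)
    (hβA : ((Fintype.card σ : ℝ)⁻¹ • ∑ a : σ, M [a]) *ᵥ β = β)
    (hαβ : α ⬝ᵥ β = 1)
    (x : Q → ℝ) (c : ℝ)
    (hx : ∀ u : List σ, UFA.rankUnMat (M u) = UFA.rankUn M → x ⬝ᵥ (M u *ᵥ β) = c) :
    ∀ w : List σ, x ⬝ᵥ (M w *ᵥ β) = c := by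
  obtain ⟨u, hu⟩ : ∃ u, UFA.rankUnMat (M u) = UFA.rankUn M := Nat.sInf_mem (Set.range_nonempty _)
  have hle : ∀ (y : Q → ℝ) (d : ℝ), (∀ w, y ⬝ᵥ (M (w ++ u) *ᵥ β) = d) →
      ∀ w, y ⬝ᵥ (M w *ᵥ β) ≤ d := by
    intro y d hy w
    refine UFA.le_of_average_of_append_eq (f := fun w => y ⬝ᵥ (M w *ᵥ β)) ?_
      (UFA.sum_dotProduct_append_mulVec hMm hβA y) hy w
    have hfin := (UFA.finite_range_of_zero_one hUn).image fun A => y ⬝ᵥ (A *ᵥ β)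
    rwa [← Set.range_comp] at hfin
  have hxu : ∀ w, x ⬝ᵥ (M (w ++ u) *ᵥ β) = c := fun w =>
    hx _ (UFA.rankUnMat_append_eq_rankUn hMm hUn hu w)
  intro w
  have hneg := hle (-x) (-c) (fun w => by rw [neg_dotProduct, hxu]) w
  rw [neg_dotProduct] at hneg
  exact le_antisymm (hle x c hxu w) (neg_le_neg_iff.1 hneg)
end

section
/- Every maximal column lies in U^⊥; that is, for every maximal column y and every word w ∈ Σ*, α^T M(w) y = α^T y. -/
open Matrix

namespace UFA

variable {Q σ : Type*} {M : List σ → Matrix Q Q ℝ}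

/-- The columns of an unambiguous morphism form a finite set. -/
lemma finite_setOf_isCol [Finite Q] (hUn : ∀ w i j, M w i j = 0 ∨ M w i j = 1) :
    {y | IsCol M y}.Finite := by
  refine (Set.Finite.pi' (fun _ : Q => Set.toFinite ({0, 1} : Set ℝ))).subset ?_
  rintro y ⟨w, q, rfl⟩ p
  simpa using hUn w p q

variable [Fintype Q]

/-- Columns are stable under left multiplication. -/
lemma IsCol.mulVec (hMm : ∀ u v, M (u ++ v) = M u * M v) {y : Q → ℝ} (hy : IsCol M y)
    (w : List σ) : IsCol M (M w *ᵥ y) := by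
  obtain ⟨v, q, rfl⟩ := hy
  refine ⟨w ++ v, q, ?_⟩
  rw [hMm]
  rfl

/-- A left eigenvector of the average matrix has the mean of its letter weights as its weight. -/
lemma sum_dotProduct_mulVec [Fintype σ] [Nonempty σ] {α : Q → ℝ}
    (hαA : α ᵥ* ((Fintype.card σ : ℝ)⁻¹ • ∑ a : σ, M [a]) = α) (y : Q → ℝ) :
    ∑ a : σ, α ⬝ᵥ (M [a] *ᵥ y) = ∑ _a : σ, α ⬝ᵥ y := by
  have hcard : (Fintype.card σ : ℝ) ≠ 0 := Nat.cast_ne_zero.mpr Fintype.card_ne_zero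
  have h : α ⬝ᵥ (((Fintype.card σ : ℝ)⁻¹ • ∑ a : σ, M [a]) *ᵥ y) = α ⬝ᵥ y := by
    rw [dotProduct_mulVec, hαA]
  rw [smul_mulVec, dotProduct_smul, sum_mulVec, dotProduct_sum, smul_eq_mul,
    inv_mul_eq_iff_eq_mul₀ hcard] at h
  simpa using h

/-- The weight of a column of maximum weight is preserved by every word. -/
lemma dotProduct_mulVec_of_forall_le [Fintype σ] [Nonempty σ] [DecidableEq Q]
    (hM0 : M [] = 1) (hMm : ∀ u v, M (u ++ v) = M u * M v) {α : Q → ℝ}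
    (hαA : α ᵥ* ((Fintype.card σ : ℝ)⁻¹ • ∑ a : σ, M [a]) = α) {c : Q → ℝ}
    (hc : IsCol M c) (hmax : ∀ y, IsCol M y → α ⬝ᵥ y ≤ α ⬝ᵥ c) (w : List σ) :
    α ⬝ᵥ (M w *ᵥ c) = α ⬝ᵥ c := by
  induction w with
  | nil => rw [hM0, one_mulVec]
  | cons a w ih =>
    have hsum := sum_dotProduct_mulVec hαA (M w *ᵥ c)
    rw [ih] at hsum
    have h := (Finset.sum_eq_sum_iff_of_le fun b _ =>
      hmax _ ((hc.mulVec hMm w).mulVec hMm [b])).mp hsum a (Finset.mem_univ a)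
    rwa [mulVec_mulVec, ← hMm] at h

/-- In a strongly connected unambiguous morphism, every maximal column is the image of any given
nonzero column under some word. -/
lemma IsMaxCol.exists_mulVec_eq (hMm : ∀ u v, M (u ++ v) = M u * M v)
    (hUn : ∀ w i j, M w i j = 0 ∨ M w i j = 1) (hSC : ∀ p q : Q, ∃ w, M w p q = 1)
    {y c : Q → ℝ} (hy : IsMaxCol M y) (hc : IsCol M c) (hc0 : c ≠ 0) :
    ∃ w, M w *ᵥ c = y := by
  have hnn : ∀ w i j, 0 ≤ M w i j := fun w i j => by
    rcases hUn w i j with h | h <;> simp [h]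
  obtain ⟨⟨v, q, rfl⟩, hmax⟩ := hy
  obtain ⟨p, hp⟩ := Function.ne_iff.mp hc0
  obtain ⟨u, r, rfl⟩ := hc
  have hp1 : M u p r = 1 := (hUn u p r).resolve_left hp
  obtain ⟨x, hx⟩ := hSC q p
  refine ⟨v ++ x, hmax _ (IsCol.mulVec hMm ⟨u, r, rfl⟩ _) fun i => ?_⟩
  have h1 : M v i q ≤ M (v ++ x) i p := by
    rw [hMm, mul_apply]
    refine le_trans ?_ (Finset.single_le_sum
      (fun j _ => mul_nonneg (hnn v i j) (hnn x j p)) (Finset.mem_univ q))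
    rw [hx, mul_one]
  have h2 : M (v ++ x) i p ≤ ∑ j, M (v ++ x) i j * M u j r := by
    refine le_trans ?_ (Finset.single_le_sum
      (fun j _ => mul_nonneg (hnn (v ++ x) i j) (hnn u j r)) (Finset.mem_univ p))
    rw [hp1, mul_one]
  exact h1.trans h2

end UFA

theorem maxCol_in_U_perp {Q σ : Type*} [Fintype Q] [DecidableEq Q] [Nonempty Q]
    [Fintype σ] [Nonempty σ]
    (M : List σ → Matrix Q Q ℝ)
    (hM0 : M [] = 1) (hMm : ∀ u v, M (u ++ v) = M u * M v)
    (hUn : ∀ w i j, M w i j = 0 ∨ M w i j = 1)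
    (hComp : ∀ w, M w ≠ 0)
    (hSC : ∀ p q : Q, ∃ w, M w p q = 1)
    (α β : Q → ℝ) (hα : ∀ q, 0 < α q) (hβ : ∀ q, 0 < β q)
    (hαA : α ᵥ* ((Fintype.card σ : ℝ)⁻¹ • ∑ a : σ, M [a]) = α)
    (hβA : ((Fintype.card σ : ℝ)⁻¹ • ∑ a : σ, M [a]) *ᵥ β = β)
    (hαβ : α ⬝ᵥ β = 1)
 :
    ∀ y : Q → ℝ, UFA.IsMaxCol M y → ∀ w : List σ, α ⬝ᵥ (M w *ᵥ y) = α ⬝ᵥ y := by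
  intro y hy w
  obtain ⟨c, hc, hmax⟩ := Set.exists_max_image _ (fun y => α ⬝ᵥ y)
    (UFA.finite_setOf_isCol hUn) ⟨y, hy.1⟩
  have hc0 : c ≠ 0 := by
    rintro rfl
    obtain ⟨q⟩ := ‹Nonempty Q›
    have hq := hmax _ ⟨[], q, rfl⟩
    have : α q ≤ 0 := by simpa [hM0, dotProduct, one_apply] using hq
    exact (hα q).not_ge this
  obtain ⟨v, rfl⟩ := hy.exists_mulVec_eq hMm hUn hSC hc hc0
  rw [mulVec_mulVec, ← hMm, UFA.dotProduct_mulVec_of_forall_le hM0 hMm hαA hc hmax,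
    UFA.dotProduct_mulVec_of_forall_le hM0 hMm hαA hc hmax]
end
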